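/- arXiv:2510.24187 — 2 statements merged into one kernel-verified Lean document; each statement's English description precedes it below -/
import Mathlib

section
/- Let d ≥ 2 be an integer, let ξ be a random vector in ℝ^d with density f, and let θ ∈ ℝ^d with θ ≠ 0. Define p_θ = θθᵀ/‖θ‖² and K(x) = S_{d−2} · ∫₀^∞ ∫₀^π ( sin^d(φ) / (r² + x² + 2 r x cos φ) ) dφ · f̃(r) · r^{d+1} dr for x ≥ 0. Then 0 < K(‖θ‖) < 1, Q := E[ ((θ+ξ)(θ+ξ)ᵀ) / ‖θ+ξ‖² ] = (K(‖θ‖)/(d−1)) · (I_d − p_θ) + (1 − K(‖θ‖)) · p_θ, and Q is nonsingular with Q⁻¹ = ((d−1)/K(‖θ‖)) · (I_d − p_θ) + (1/(1 − K(‖θ‖))) · p_θ. -/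
noncomputable section
open MeasureTheory ProbabilityTheory Real Matrix
open scoped RealInnerProductSpace

/-- `E d` is the Euclidean space `ℝ^d`. -/
abbrev E (d : ℕ) : Type := EuclideanSpace ℝ (Fin d)

/-- The radial profile `f̃` of the ball perturbation density: `fball d x = ftilde d ‖x‖`. -/
def ftilde (d : ℕ) (r : ℝ) : ℝ :=
  (Real.Gamma ((d : ℝ) + 1/2) / (2 * Real.pi ^ ((d : ℝ)/2) * Real.Gamma (((d : ℝ) + 1)/2))) *
    ∫ t in (0:ℝ)..1, t ^ (((d : ℝ) - 1)/2) * (1 + t * r^2) ^ (-(d : ℝ) - 1/2)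

/-- The density on `ℝ^d` of the self-concordant perturbation for the Euclidean ball. -/
def fball (d : ℕ) (x : E d) : ℝ := ftilde d ‖x‖

/-- The ball perturbation, as a measure on `ℝ^d`. -/
def ballPert (d : ℕ) : Measure (E d) :=
  volume.withDensity fun x => ENNReal.ofReal (fball d x)

/-- `S_n = 2 π^{(n+1)/2} / Γ((n+1)/2)`, the surface area of the unit `n`-sphere. -/
def sphereArea (n : ℕ) : ℝ := 2 * Real.pi ^ (((n : ℝ) + 1)/2) / Real.Gamma (((n : ℝ) + 1)/2)

/-- `K(x) = S_{d−2} ∫₀^∞ (∫₀^π sin^d φ/(r²+x²+2rx cos φ) dφ) f̃(r) r^{d+1} dr`. -/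
def Kfun (d : ℕ) (x : ℝ) : ℝ :=
  sphereArea (d-2) * ∫ r in Set.Ioi (0:ℝ),
    (∫ φ in (0:ℝ)..Real.pi, (Real.sin φ)^d / (r^2 + x^2 + 2*r*x*Real.cos φ)) *
      ftilde d r * r^(d+1)

lemma sphereArea_eq_card_mul_volume_ball (k : ℕ) :
    (k + 1 : ℕ) • volume.real (Metric.ball (0 : E (k + 1)) 1) = sphereArea k := by
  have hΓ : Real.Gamma (((k : ℝ) + 1) / 2) ≠ 0 := (Real.Gamma_pos_of_pos (by positivity)).ne'
  have hk : (k : ℝ) + 1 ≠ 0 := by positivity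
  rw [measureReal_def, EuclideanSpace.volume_ball, ENNReal.ofReal_one, one_pow, one_mul,
    Fintype.card_fin, ENNReal.toReal_ofReal
      (div_nonneg (by positivity) (Real.Gamma_nonneg_of_nonneg (by positivity))),
    sphereArea, Real.sqrt_eq_rpow, ← Real.rpow_natCast, ← Real.rpow_mul pi_pos.le, nsmul_eq_mul]
  push_cast
  rw [Real.Gamma_add_one (by positivity), show 1 / 2 * ((k : ℝ) + 1) = (k + 1) / 2 by ring]
  field_simp

lemma measurePreserving_head_tail (n : ℕ) :
    MeasurePreserving (fun y : E (n + 1) =>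
      (y 0, (WithLp.toLp 2 fun i : Fin n => y i.succ : E n))) volume (volume.prod volume) := by
  have h1 := PiLp.volume_preserving_ofLp (Fin (n + 1))
  have h2 := volume_preserving_piFinSuccAbove (fun _ : Fin (n + 1) => ℝ) 0
  have h3 := (MeasurePreserving.id (volume : Measure ℝ)).prod (PiLp.volume_preserving_toLp (Fin n))
  exact (h3.comp h2).comp h1

lemma measurableEmbedding_head_tail (n : ℕ) :
    MeasurableEmbedding (fun y : E (n + 1) =>
      (y 0, (WithLp.toLp 2 fun i : Fin n => y i.succ : E n))) := by
  have := ((MeasurableEquiv.prodCongr (MeasurableEquiv.refl ℝ)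
      (MeasurableEquiv.toLp 2 (Fin n → ℝ))).measurableEmbedding.comp
    (MeasurableEquiv.piFinSuccAbove (fun _ : Fin (n + 1) => ℝ) 0).measurableEmbedding).comp
    (MeasurableEquiv.toLp 2 (Fin (n + 1) → ℝ)).symm.measurableEmbedding
  exact this

lemma integrableOn_polarCoord_symm {f : ℝ × ℝ → ℝ} (hf : Integrable f) (hm : Measurable f) :
    IntegrableOn (fun p : ℝ × ℝ => p.1 * f (polarCoord.symm p)) polarCoord.target := by
  have hms : Measurable fun p : ℝ × ℝ => p.1 * f (polarCoord.symm p) :=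
    measurable_fst.mul (hm.comp continuous_polarCoord_symm.measurable)
  refine ⟨hms.aestronglyMeasurable, ?_⟩
  have h := lintegral_comp_polarCoord_symm fun p => ‖f p‖ₑ
  rw [hasFiniteIntegral_iff_enorm]
  calc _ = ∫⁻ p in polarCoord.target, ENNReal.ofReal p.1 • ‖f (polarCoord.symm p)‖ₑ := by
        refine setLIntegral_congr_fun polarCoord.open_target.measurableSet fun p hp => ?_
        have : 0 < p.1 := hp.1
        simp only [enorm_mul, smul_eq_mul]
        rw [Real.enorm_of_nonneg this.le]
    _ < ⊤ := by rw [h]; exact hf.2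

lemma integral_upper_half_plane_polar {f : ℝ × ℝ → ℝ} (hm : Measurable f)
    (hf : IntegrableOn f (Set.univ ×ˢ Set.Ioi 0)) :
    ∫ p in Set.univ ×ˢ Set.Ioi 0, f p =
      ∫ r in Set.Ioi (0 : ℝ), ∫ φ in (0 : ℝ)..π, r * f (r * cos φ, r * sin φ) := by
  have hS : MeasurableSet ((Set.univ : Set ℝ) ×ˢ Set.Ioi (0 : ℝ)) :=
    MeasurableSet.univ.prod measurableSet_Ioi
  have hi := integrableOn_polarCoord_symm (hf.integrable_indicator hS) (hm.indicator hS)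
  rw [← integral_indicator hS, ← integral_comp_polarCoord_symm]
  simp only [smul_eq_mul]
  rw [polarCoord_target] at hi ⊢
  rw [Measure.volume_eq_prod] at hi ⊢
  rw [setIntegral_prod _ hi]
  refine setIntegral_congr_fun measurableSet_Ioi fun r hr => ?_
  have hr : 0 < r := hr
  rw [intervalIntegral.integral_of_le pi_pos.le, ← integral_Ioc_eq_integral_Ioo,
    ← integral_indicator measurableSet_Ioc, ← integral_indicator measurableSet_Ioc]
  refine integral_congr_ae ?_
  filter_upwards [compl_mem_ae_iff.2 (measure_singleton π)] with φ hφ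
  have hφ : φ ≠ π := hφ
  simp only [Set.indicator_apply, Set.mem_Ioc, polarCoord_symm_apply, Set.mem_prod, Set.mem_univ,
    true_and, Set.mem_Ioi]
  by_cases h0 : 0 < φ
  · have hπ : -π < φ := by linarith [pi_pos]
    by_cases h1 : φ ≤ π
    · have : 0 < r * sin φ := mul_pos hr (sin_pos_of_pos_of_lt_pi h0 (lt_of_le_of_ne h1 hφ))
      simp [h0, h1, hπ, this]
    · simp [h1]
  · by_cases h1 : -π < φ
    · have : r * sin φ ≤ 0 :=
        mul_nonpos_of_nonneg_of_nonpos hr.le (sin_nonpos_of_nonpos_of_neg_pi_le (not_lt.1 h0) h1.le)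
      simp [h0, this.not_gt]
    · simp [h0, h1]

lemma integral_cylindrical (k : ℕ) {G : ℝ × ℝ → ℝ} (hG : Measurable G)
    (hi : Integrable fun y : E (k + 2) =>
      G (y 0, ‖(WithLp.toLp 2 fun i : Fin (k + 1) => y i.succ : E (k + 1))‖)) :
    ∫ y : E (k + 2), G (y 0, ‖(WithLp.toLp 2 fun i : Fin (k + 1) => y i.succ : E (k + 1))‖) =
      sphereArea k * ∫ r in Set.Ioi (0 : ℝ), ∫ φ in (0 : ℝ)..π,
        r * ((r * sin φ) ^ k * G (r * cos φ, r * sin φ)) := by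
  have hmp := measurePreserving_head_tail (k + 1)
  have hme := measurableEmbedding_head_tail (k + 1)
  have hi' : Integrable (fun p : ℝ × E (k + 1) => G (p.1, ‖p.2‖)) (volume.prod volume) :=
    (hmp.integrable_comp_emb hme (g := fun p : ℝ × E (k + 1) => G (p.1, ‖p.2‖))).1 hi
  have hrad : ∀ g : ℝ → ℝ, ∫ z : E (k + 1), g ‖z‖ =
      sphereArea k * ∫ y in Set.Ioi (0 : ℝ), y ^ k * g y := fun g => by
    rw [integral_fun_norm_addHaar, ← smul_assoc, finrank_euclideanSpace, Fintype.card_fin,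
      sphereArea_eq_card_mul_volume_ball]
    simp
  have hS : 0 < sphereArea k :=
    div_pos (by positivity) (Real.Gamma_pos_of_pos (by positivity))
  have hmeas : Measurable fun p : ℝ × ℝ => p.2 ^ k * G p := by fun_prop
  have hint : Integrable (fun p : ℝ × ℝ => p.2 ^ k * G p)
      (volume.prod (volume.restrict (Set.Ioi 0))) := by
    rw [integrable_prod_iff hmeas.aestronglyMeasurable]
    rw [integrable_prod_iff hi'.aestronglyMeasurable] at hi'
    refine ⟨hi'.1.mono fun u hu => ?_, ?_⟩
    · have := (integrable_fun_norm_addHaar (volume : Measure (E (k + 1)))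
        (f := fun ρ => G (u, ρ))).1 hu
      simpa [IntegrableOn] using this
    · refine (hi'.2.const_mul (sphereArea k)⁻¹).congr (Filter.Eventually.of_forall fun u => ?_)
      simp only
      rw [hrad fun ρ => ‖G (u, ρ)‖, inv_mul_cancel_left₀ hS.ne']
      refine setIntegral_congr_fun measurableSet_Ioi fun ρ hρ => ?_
      have hρ : 0 < ρ := hρ
      simp [abs_of_pos hρ]
  have hprod : (volume : Measure ℝ).prod (volume.restrict (Set.Ioi (0 : ℝ))) =
      (volume : Measure (ℝ × ℝ)).restrict (Set.univ ×ˢ Set.Ioi 0) := by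
    rw [Measure.volume_eq_prod, ← Measure.prod_restrict, Measure.restrict_univ]
  rw [← integral_upper_half_plane_polar hmeas (by rw [IntegrableOn, ← hprod]; exact hint),
    ← hprod, integral_prod _ hint, ← integral_const_mul]
  refine (hmp.integral_comp hme fun p : ℝ × E (k + 1) => G (p.1, ‖p.2‖)).trans ?_
  rw [integral_prod _ hi']
  exact integral_congr_ae (Filter.Eventually.of_forall fun u => hrad fun ρ => G (u, ρ))

lemma measurable_ftilde (d : ℕ) : Measurable (ftilde d) := by
  unfold ftilde
  refine measurable_const.mul ?_
  simp only [intervalIntegral.integral_of_le zero_le_one]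
  have h : Measurable (Function.uncurry fun r t : ℝ =>
      t ^ (((d : ℝ) - 1) / 2) * (1 + t * r ^ 2) ^ (-(d : ℝ) - 1 / 2)) := by
    unfold Function.uncurry
    fun_prop
  exact (h.stronglyMeasurable.integral_prod_right).measurable

lemma ftilde_nonneg (d : ℕ) (r : ℝ) : 0 ≤ ftilde d r := by
  refine mul_nonneg (div_nonneg (Real.Gamma_nonneg_of_nonneg (by positivity))
    (mul_nonneg (by positivity) (Real.Gamma_nonneg_of_nonneg (by positivity)))) ?_
  refine intervalIntegral.integral_nonneg zero_le_one fun t ht => ?_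
  have := ht.1
  positivity

lemma measurable_fball (d : ℕ) : Measurable (fball d) :=
  (measurable_ftilde d).comp measurable_norm

lemma integral_ballPert {d : ℕ} (g : E d → ℝ) :
    ∫ x, g x ∂ballPert d = ∫ x, fball d x * g x := by
  rw [ballPert, integral_withDensity_eq_integral_toReal_smul
    (measurable_fball d).ennreal_ofReal (by simp)]
  simp [ENNReal.toReal_ofReal (ftilde_nonneg d _), fball]

lemma integrable_ballPert_iff {d : ℕ} {g : E d → ℝ} :
    Integrable g (ballPert d) ↔ Integrable fun x => fball d x * g x := by
  rw [ballPert, integrable_withDensity_iff_integrable_smul'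
    (measurable_fball d).ennreal_ofReal (by simp)]
  simp [ENNReal.toReal_ofReal (ftilde_nonneg d _), fball]

lemma measurePreserving_ballPert {d : ℕ} (R : E d ≃ₗᵢ[ℝ] E d) :
    MeasurePreserving R (ballPert d) (ballPert d) := by
  refine ⟨R.continuous.measurable, Measure.ext fun s hs => ?_⟩
  rw [Measure.map_apply R.continuous.measurable hs, ballPert, withDensity_apply _ hs,
    withDensity_apply _ (R.continuous.measurable hs),
    ← R.measurePreserving.setLIntegral_comp_preimage hs (measurable_fball d).ennreal_ofReal]
  simp [fball]

/-- The bilinear form `(v, w) ↦ E[⟪θ + ξ, v⟫ ⟪θ + ξ, w⟫ / ‖θ + ξ‖²]`, where `ξ` is the ball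
perturbation. -/
def secondMoment {d : ℕ} (θ v w : E d) : ℝ :=
  ∫ x, ⟪θ + x, v⟫ * ⟪θ + x, w⟫ / ‖θ + x‖ ^ 2 ∂ballPert d

lemma ballPert_ae_inner_ne_zero {d : ℕ} (θ : E d) {v : E d} (hv : v ≠ 0) :
    ∀ᵐ x ∂ballPert d, ⟪θ + x, v⟫ ≠ 0 := by
  refine (withDensity_absolutelyContinuous _ _).ae_le ?_
  have hne : (LinearMap.ker (innerSL ℝ v).toLinearMap) ≠ ⊤ := fun h => by
    have : v ∈ LinearMap.ker (innerSL ℝ v).toLinearMap := h ▸ Submodule.mem_top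
    simp [hv] at this
  have h0 := Measure.addHaar_submodule (volume : Measure (E d)) _ hne
  have h1 := (measurePreserving_add_left
    (volume : Measure (E d)) θ).quasiMeasurePreserving.preimage_null h0
  change volume _ = 0
  convert h1 using 2
  ext x
  simp [real_inner_comm v]

lemma secondMoment_map {d : ℕ} {θ : E d} {R : E d ≃ₗᵢ[ℝ] E d} (hR : R θ = θ) (v w : E d) :
    secondMoment θ (R v) (R w) = secondMoment θ v w := by
  unfold secondMoment
  rw [← (measurePreserving_ballPert R).integral_comp R.toHomeomorph.measurableEmbedding]
  have h : ∀ x, θ + R x = R (θ + x) := fun x => by rw [map_add, hR]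
  simp only [h, R.inner_map_map, R.norm_map]

section secondMoment

variable {d : ℕ} [IsProbabilityMeasure (ballPert d)] (θ : E d)

lemma integrable_secondMoment (v w : E d) :
    Integrable (fun x => ⟪θ + x, v⟫ * ⟪θ + x, w⟫ / ‖θ + x‖ ^ 2) (ballPert d) := by
  refine Integrable.of_bound (C := ‖v‖ * ‖w‖) ?_ (Filter.Eventually.of_forall fun x => ?_)
  · exact Measurable.aestronglyMeasurable (by fun_prop)
  · rw [norm_div, norm_mul, norm_pow, norm_norm]
    refine div_le_of_le_mul₀ (by positivity) (by positivity) ?_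
    calc ‖⟪θ + x, v⟫‖ * ‖⟪θ + x, w⟫‖ ≤ (‖θ + x‖ * ‖v‖) * (‖θ + x‖ * ‖w‖) := by
          gcongr <;> exact norm_inner_le_norm _ _
      _ = ‖v‖ * ‖w‖ * ‖θ + x‖ ^ 2 := by ring

lemma secondMoment_self_pos {v : E d} (hv : v ≠ 0) : 0 < secondMoment θ v v := by
  have hnn : ∀ x, 0 ≤ ⟪θ + x, v⟫ * ⟪θ + x, v⟫ / ‖θ + x‖ ^ 2 := fun x =>
    div_nonneg (mul_self_nonneg _) (by positivity)
  refine (integral_nonneg hnn).lt_of_ne' fun h => ?_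
  rw [integral_eq_zero_iff_of_nonneg hnn (integrable_secondMoment θ v v)] at h
  obtain ⟨x, hx, hx'⟩ := (h.and (ballPert_ae_inner_ne_zero θ hv)).exists
  have h0 : θ + x ≠ 0 := fun h0 => hx' (by simp [h0])
  have : ‖θ + x‖ ≠ 0 := norm_ne_zero_iff.2 h0
  simp [hx', this] at hx

lemma sum_secondMoment_self {ι : Type*} [Fintype ι] (hd : d ≠ 0)
    (b : OrthonormalBasis ι ℝ (E d)) : ∑ i, secondMoment θ (b i) (b i) = 1 := by
  have : Nonempty (Fin d) := ⟨⟨0, Nat.pos_of_ne_zero hd⟩⟩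
  obtain ⟨v, hv⟩ := exists_ne (0 : E d)
  unfold secondMoment
  rw [← integral_finsetSum _ fun i _ => integrable_secondMoment θ _ _]
  rw [integral_congr_ae (g := fun _ => (1 : ℝ))]
  · simp
  · filter_upwards [ballPert_ae_inner_ne_zero θ hv] with x hx
    have h0 : θ + x ≠ 0 := fun h0 => hx (by simp [h0])
    have h1 := b.sum_sq_inner_left (θ + x)
    simp only [← Finset.sum_div, ← sq]
    rw [h1, div_self (by simpa using h0)]

lemma secondMoment_eq_sum {ι : Type*} [Fintype ι] (b : OrthonormalBasis ι ℝ (E d)) (v w : E d) :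
    secondMoment θ v w = ∑ i, ∑ j, ⟪b i, v⟫ * ⟪b j, w⟫ * secondMoment θ (b i) (b j) := by
  unfold secondMoment
  simp_rw [← integral_const_mul]
  simp_rw [← integral_finsetSum Finset.univ fun j _ =>
    (integrable_secondMoment θ (b _) (b j)).const_mul _]
  rw [← integral_finsetSum Finset.univ fun i _ => integrable_finsetSum Finset.univ fun j _ =>
    (integrable_secondMoment θ (b i) (b j)).const_mul _]
  refine integral_congr_ae (Filter.Eventually.of_forall fun x => ?_)
  simp only
  rw [← b.sum_inner_mul_inner (θ + x) v, ← b.sum_inner_mul_inner (θ + x) w, Finset.sum_mul_sum,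
    Finset.sum_div]
  refine Finset.sum_congr rfl fun i _ => ?_
  rw [Finset.sum_div]
  exact Finset.sum_congr rfl fun j _ => by ring

end secondMoment

lemma exists_orthonormalBasis_head {n : ℕ} {θ : E (n + 1)} (hθ : θ ≠ 0) :
    ∃ b : OrthonormalBasis (Fin (n + 1)) ℝ (E (n + 1)), θ = ‖θ‖ • b 0 := by
  have hn : ‖θ‖ ≠ 0 := norm_ne_zero_iff.2 hθ
  have ho : Orthonormal ℝ (Set.domRestrict {(0 : Fin (n + 1))} fun _ => ‖θ‖⁻¹ • θ) := by
    refine ⟨fun i => ?_, fun i j hij => absurd (Subsingleton.elim i j) hij⟩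
    simp [norm_smul, hn]
  obtain ⟨b, hb⟩ := ho.exists_orthonormalBasis_extension_of_card_eq (by simp)
  refine ⟨b, ?_⟩
  rw [hb 0 rfl, smul_smul, mul_inv_cancel₀ hn, one_smul]

lemma secondMoment_orthonormalBasis {n : ℕ} [IsProbabilityMeasure (ballPert (n + 1))]
    {θ : E (n + 1)} (b : OrthonormalBasis (Fin (n + 1)) ℝ (E (n + 1))) (hb : θ = ‖θ‖ • b 0) :
    (∀ i j, i ≠ j → secondMoment θ (b i) (b j) = 0) ∧
    ∀ i j, i ≠ 0 → j ≠ 0 → secondMoment θ (b i) (b i) = secondMoment θ (b j) (b j) := by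
  have horth : ∀ i j, i ≠ j → ⟪b i, b j⟫ = 0 := fun i j h => b.orthonormal.2 h
  have hfix : ∀ (v w : E (n + 1)), ⟪v, w⟫ = 0 → (Submodule.span ℝ {v})ᗮ.reflection w = w :=
    fun v w h => Submodule.reflection_mem_subspace_eq_self
      (Submodule.mem_orthogonal_singleton_iff_inner_right.2 h)
  have key : ∀ i j, i ≠ 0 → i ≠ j → secondMoment θ (b i) (b j) = 0 := fun i j hi hij => by
    have h := secondMoment_map (θ := θ) (R := (Submodule.span ℝ {b i})ᗮ.reflection)
      (hfix _ _ (by rw [hb, inner_smul_right, horth i 0 hi, mul_zero])) (b i) (b j)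
    rw [Submodule.reflection_orthogonalComplement_singleton_eq_neg, hfix _ _ (horth i j hij)] at h
    have h2 : secondMoment θ (-b i) (b j) = -secondMoment θ (b i) (b j) := by
      simp [secondMoment, neg_div, integral_neg]
    linarith
  refine ⟨fun i j hij => ?_, fun i j hi hj => ?_⟩
  · by_cases hi : i = 0
    · have : secondMoment θ (b i) (b j) = secondMoment θ (b j) (b i) := by
        simp only [secondMoment, mul_comm]
      rw [this]
      exact key j i (fun hj => hij (hi.trans hj.symm)) hij.symm
    · exact key i j hi hij
  · have h := secondMoment_map (θ := θ) (R := (Submodule.span ℝ {b i - b j})ᗮ.reflection)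
      (hfix _ _ (by
        rw [hb, inner_smul_right, inner_sub_left, horth i 0 hi, horth j 0 hj]; simp)) (b i) (b i)
    rw [Submodule.reflection_sub (by simp)] at h
    exact h.symm

lemma sum_succ_secondMoment_eq_Kfun {k : ℕ} [IsProbabilityMeasure (ballPert (k + 2))]
    {θ : E (k + 2)} (b : OrthonormalBasis (Fin (k + 2)) ℝ (E (k + 2))) (hb : θ = ‖θ‖ • b 0) :
    ∑ i : Fin (k + 1), secondMoment θ (b i.succ) (b i.succ) = Kfun (k + 2) ‖θ‖ := by
  set a := ‖θ‖ with ha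
  let G : ℝ × ℝ → ℝ := fun p =>
    ftilde (k + 2) √(p.1 ^ 2 + p.2 ^ 2) * (p.2 ^ 2 / ((a + p.1) ^ 2 + p.2 ^ 2))
  have hG : Measurable G := by
    have := measurable_ftilde (k + 2)
    fun_prop
  have hcomp : ∀ x : E (k + 2), fball (k + 2) x *
      ∑ i : Fin (k + 1), ⟪θ + x, b i.succ⟫ * ⟪θ + x, b i.succ⟫ / ‖θ + x‖ ^ 2 =
      G (b.repr x 0, ‖(WithLp.toLp 2 fun i : Fin (k + 1) => b.repr x i.succ : E (k + 1))‖) := by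
    intro x
    have h0 : ⟪θ + x, b 0⟫ = a + b.repr x 0 := by
      rw [inner_add_left, b.repr_apply_apply, real_inner_comm x]
      nth_rw 1 [hb]
      simp [real_inner_smul_left]
    have hs : ∀ i : Fin (k + 1), ⟪θ + x, b i.succ⟫ = b.repr x i.succ := fun i => by
      rw [inner_add_left, b.repr_apply_apply, real_inner_comm x]
      have : ⟪b 0, b i.succ⟫ = 0 := b.orthonormal.2 (Fin.succ_ne_zero i).symm
      nth_rw 1 [hb]
      simp [real_inner_smul_left, this]
    have hn : ‖θ + x‖ ^ 2 = (a + b.repr x 0) ^ 2 + ∑ i : Fin (k + 1), b.repr x i.succ ^ 2 := by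
      rw [← b.sum_sq_inner_left, Fin.sum_univ_succ, h0]
      simp [hs]
    have hx : ‖x‖ = √(b.repr x 0 ^ 2 + ∑ i : Fin (k + 1), b.repr x i.succ ^ 2) := by
      rw [← b.repr.norm_map x, EuclideanSpace.norm_eq, Fin.sum_univ_succ]
      simp
    have ht : ‖(WithLp.toLp 2 fun i : Fin (k + 1) => b.repr x i.succ : E (k + 1))‖ ^ 2 =
        ∑ i : Fin (k + 1), b.repr x i.succ ^ 2 := by
      rw [EuclideanSpace.real_norm_sq_eq]
    simp only [G, fball, ht, hn, hs, hx, ← Finset.sum_div, ← sq]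
  have hint : ∀ i : Fin (k + 1), Integrable (fun x =>
      ⟪θ + x, b i.succ⟫ * ⟪θ + x, b i.succ⟫ / ‖θ + x‖ ^ 2) (ballPert (k + 2)) :=
    fun i => integrable_secondMoment θ _ _
  have hmp := b.repr.measurePreserving
  have hme := b.repr.toHomeomorph.measurableEmbedding
  have hi : Integrable fun y : E (k + 2) =>
      G (y 0, ‖(WithLp.toLp 2 fun i : Fin (k + 1) => y i.succ : E (k + 1))‖) := by
    rw [← hmp.integrable_comp_emb hme]
    refine (integrable_ballPert_iff.1 (integrable_finsetSum Finset.univ fun i _ => hint i)).congr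
      (Filter.Eventually.of_forall hcomp)
  unfold secondMoment
  rw [← integral_finsetSum _ fun i _ => hint i, integral_ballPert,
    integral_congr_ae (Filter.Eventually.of_forall hcomp)]
  refine (hmp.integral_comp hme fun y : E (k + 2) =>
    G (y 0, ‖(WithLp.toLp 2 fun i : Fin (k + 1) => y i.succ : E (k + 1))‖)).trans ?_
  rw [integral_cylindrical k hG hi, Kfun, Nat.add_sub_cancel]
  congr 1
  refine setIntegral_congr_fun measurableSet_Ioi fun r hr => ?_
  have hr : 0 < r := hr
  simp only [G]
  rw [mul_assoc, ← intervalIntegral.integral_mul_const]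
  refine intervalIntegral.integral_congr fun φ _ => ?_
  have h1 : (r * cos φ) ^ 2 + (r * sin φ) ^ 2 = r ^ 2 := by
    linear_combination r ^ 2 * sin_sq_add_cos_sq φ
  have h2 : (a + r * cos φ) ^ 2 + (r * sin φ) ^ 2 = r ^ 2 + a ^ 2 + 2 * r * a * cos φ := by
    linear_combination r ^ 2 * sin_sq_add_cos_sq φ
  simp only [h1, h2, Real.sqrt_sq hr.le]
  ring

lemma smul_one_sub_add_smul_mul_inv_eq_one {n : Type*} [Fintype n] [DecidableEq n]
    {P : Matrix n n ℝ} (hP : P * P = P) {a c : ℝ} (ha : a ≠ 0) (hc : c ≠ 0) :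
    (a • (1 - P) + c • P) * (a⁻¹ • (1 - P) + c⁻¹ • P) = 1 := by
  have h1 : (1 - P) * (1 - P) = 1 - P := by simp [sub_mul, mul_sub, hP]
  have h2 : (1 - P) * P = 0 := by simp [sub_mul, hP]
  have h3 : P * (1 - P) = 0 := by simp [mul_sub, hP]
  simp [add_mul, mul_add, h1, h2, h3, hP, ha, hc]

/-- closed form of the second-moment matrix on the ball.
For `ξ` with density `fball d` and `θ ≠ 0`, with `p_θ = θθᵀ/‖θ‖²`:
`0 < K(‖θ‖) < 1`, `Q = E[(θ+ξ)(θ+ξ)ᵀ/‖θ+ξ‖²] = (K(‖θ‖)/(d−1))(I − p_θ) + (1−K(‖θ‖)) p_θ`,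
and `Q` is nonsingular with
`Q⁻¹ = ((d−1)/K(‖θ‖))(I − p_θ) + (1/(1−K(‖θ‖))) p_θ`. -/
theorem statement17 {d : ℕ} (hd : 2 ≤ d)
    {Ω : Type} [MeasurableSpace Ω] (μ : Measure Ω) [IsProbabilityMeasure μ]
    (ξ : Ω → E d) (hξmeas : Measurable ξ) (hξlaw : μ.map ξ = ballPert d)
    (θ : E d) (hθ : θ ≠ 0)
    (P : Matrix (Fin d) (Fin d) ℝ) (hP : P = (1/‖θ‖^2) • Matrix.vecMulVec θ θ)
    (Q : Matrix (Fin d) (Fin d) ℝ)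
    (hQ : ∀ i j, Q i j = ∫ ω, (θ i + ξ ω i) * (θ j + ξ ω j) / ‖θ + ξ ω‖^2 ∂μ) :
    0 < Kfun d ‖θ‖ ∧ Kfun d ‖θ‖ < 1 ∧
    Q = (Kfun d ‖θ‖ / ((d : ℝ) - 1)) • ((1 : Matrix (Fin d) (Fin d) ℝ) - P) +
        (1 - Kfun d ‖θ‖) • P ∧
    IsUnit Q.det ∧
    Q⁻¹ = (((d : ℝ) - 1) / Kfun d ‖θ‖) • ((1 : Matrix (Fin d) (Fin d) ℝ) - P) +
        (1 / (1 - Kfun d ‖θ‖)) • P := by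
  obtain ⟨k, rfl⟩ := Nat.exists_eq_add_of_le' hd
  have : IsProbabilityMeasure (ballPert (k + 2)) :=
    hξlaw ▸ Measure.isProbabilityMeasure_map hξmeas.aemeasurable
  have hn : ‖θ‖ ≠ 0 := norm_ne_zero_iff.2 hθ
  obtain ⟨b, hb⟩ := exists_orthonormalBasis_head hθ
  obtain ⟨hoff, hdiag⟩ := secondMoment_orthonormalBasis b hb
  have hK := sum_succ_secondMoment_eq_Kfun b hb
  have hsum := sum_secondMoment_self θ (by omega) b
  rw [Fin.sum_univ_succ, hK] at hsum
  have hb0 : ∀ i, b i ≠ 0 := fun i => b.orthonormal.ne_zero i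
  have h0 := secondMoment_self_pos θ (hb0 0)
  have h1 := secondMoment_self_pos θ (hb0 1)
  have hA : ∀ i : Fin (k + 1), secondMoment θ (b i.succ) (b i.succ) =
      secondMoment θ (b 1) (b 1) := fun i =>
    hdiag _ _ (Fin.succ_ne_zero i) (by simp)
  simp only [hA, Finset.sum_const, Finset.card_univ, Fintype.card_fin, nsmul_eq_mul] at hK
  have hk : (0 : ℝ) < ((k + 1 : ℕ) : ℝ) := by positivity
  have hcast : ((k + 2 : ℕ) : ℝ) - 1 = ((k + 1 : ℕ) : ℝ) := by push_cast; ring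
  have hKpos : 0 < Kfun (k + 2) ‖θ‖ := hK ▸ mul_pos hk h1
  have hKlt : Kfun (k + 2) ‖θ‖ < 1 := by linarith
  have hC : secondMoment θ (b 0) (b 0) = 1 - Kfun (k + 2) ‖θ‖ := by linarith
  have hA1 : secondMoment θ (b 1) (b 1) = Kfun (k + 2) ‖θ‖ / ((k + 1 : ℕ) : ℝ) := by
    rw [← hK]; field_simp
  have hform : ∀ v w : E (k + 2), secondMoment θ v w =
      Kfun (k + 2) ‖θ‖ / ((k + 1 : ℕ) : ℝ) * (⟪v, w⟫ - ⟪b 0, v⟫ * ⟪b 0, w⟫) +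
        (1 - Kfun (k + 2) ‖θ‖) * (⟪b 0, v⟫ * ⟪b 0, w⟫) := fun v w => by
    have hd1 : ∀ i, ∑ j, ⟪b i, v⟫ * ⟪b j, w⟫ * secondMoment θ (b i) (b j) =
        ⟪b i, v⟫ * ⟪b i, w⟫ * secondMoment θ (b i) (b i) := fun i =>
      Finset.sum_eq_single i (fun j _ hj => by rw [hoff i j hj.symm, mul_zero]) (by simp)
    rw [secondMoment_eq_sum θ b, ← b.sum_inner_mul_inner v w]
    simp only [hd1, Fin.sum_univ_succ (n := k + 1), hA, hC, hA1, ← Finset.sum_mul,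
      real_inner_comm _ v]
    ring
  have hQe : Q = (Kfun (k + 2) ‖θ‖ / (((k + 2 : ℕ) : ℝ) - 1)) •
      ((1 : Matrix (Fin (k + 2)) (Fin (k + 2)) ℝ) - P) + (1 - Kfun (k + 2) ‖θ‖) • P := by
    ext i j
    have hb0c : ∀ i, ⟪b 0, EuclideanSpace.single i (1 : ℝ)⟫ = θ i / ‖θ‖ := fun i => by
      have : θ i = ‖θ‖ * b 0 i := by nth_rw 1 [hb]; rfl
      rw [this, EuclideanSpace.inner_single_right]
      simp [hn]
    have hQij : Q i j = secondMoment θ (EuclideanSpace.single i 1) (EuclideanSpace.single j 1) := by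
      rw [hQ, secondMoment, ← hξlaw, integral_map hξmeas.aemeasurable
        (Measurable.aestronglyMeasurable (by fun_prop))]
      simp [EuclideanSpace.inner_single_right]
    rw [hQij, hform, hb0c, hb0c, hcast, hP]
    simp [Matrix.vecMulVec_apply, Matrix.one_apply, EuclideanSpace.inner_single_right, eq_comm]
    field_simp
  have hPP : P * P = P := by
    have : θ ⬝ᵥ θ = ‖θ‖ ^ 2 := by
      rw [EuclideanSpace.real_norm_sq_eq]
      simp [dotProduct, sq]
    rw [hP, smul_mul_smul_comm, vecMulVec_mul_vecMulVec, this, vecMulVec_smul, smul_smul]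
    congr 1
    field_simp
  have hinv := smul_one_sub_add_smul_mul_inv_eq_one hPP
    (a := Kfun (k + 2) ‖θ‖ / (((k + 2 : ℕ) : ℝ) - 1)) (c := 1 - Kfun (k + 2) ‖θ‖)
    (div_pos hKpos (hcast ▸ hk)).ne' (by linarith)
  rw [← hQe, inv_div, ← one_div (1 - Kfun _ _)] at hinv
  exact ⟨hKpos, hKlt, hQe, Matrix.isUnit_det_of_right_inverse hinv,
    Matrix.inv_eq_right_inv hinv⟩
end
end

section
/- Let d ≥ 2 be an integer and define K(x) = S_{d−2} · ∫₀^∞ ∫₀^π ( sin^d(φ) / (r² + x² + 2 r x cos φ) ) dφ · f̃(r) · r^{d+1} dr for x ≥ 0. Then for all x ≥ 0, (d−1)/(d(x+2)) ≤ K(x) ≤ (d−1)/d. -/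
noncomputable section
open MeasureTheory ProbabilityTheory Real Matrix
open scoped RealInnerProductSpace

theorem integral_Ioo_rpow_mul_one_sub_rpow {a b : ℝ} (ha : 0 < a) (hb : 0 < b) :
    ∫ u in Set.Ioo (0:ℝ) 1, u ^ (a - 1) * (1 - u) ^ (b - 1) = beta a b := by
  have h : Complex.betaIntegral a b = ((∫ u in (0:ℝ)..1, u ^ (a - 1) * (1 - u) ^ (b - 1) : ℝ) : ℂ) := by
    rw [Complex.betaIntegral, ← intervalIntegral.integral_ofReal]
    refine intervalIntegral.integral_congr fun u hu => ?_
    rw [Set.uIcc_of_le zero_le_one] at hu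
    simp only [Complex.ofReal_mul]
    rw [Complex.ofReal_cpow hu.1, Complex.ofReal_cpow (by linarith [hu.2])]
    push_cast
    rfl
  rw [beta_eq_betaIntegralReal a b ha hb, h, Complex.ofReal_re,
    intervalIntegral.integral_of_le zero_le_one, integral_Ioc_eq_integral_Ioo]

theorem image_sq_div_one_add_sq_Ioi :
    (fun v : ℝ => v ^ 2 / (1 + v ^ 2)) '' Set.Ioi 0 = Set.Ioo 0 1 := by
  ext u
  constructor
  · rintro ⟨v, hv, rfl⟩
    have hv : 0 < v := hv
    refine ⟨by positivity, ?_⟩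
    rw [div_lt_one (by positivity)]
    linarith
  · rintro ⟨h0, h1⟩
    have h1' : 0 < 1 - u := by linarith
    refine ⟨√(u / (1 - u)), Real.sqrt_pos.2 (by positivity), ?_⟩
    dsimp only
    rw [Real.sq_sqrt (by positivity)]
    field_simp
    ring

theorem injOn_sq_div_one_add_sq :
    Set.InjOn (fun v : ℝ => v ^ 2 / (1 + v ^ 2)) (Set.Ioi 0) := by
  intro v hv w hw h
  have hv : 0 < v := hv
  have hw : 0 < w := hw
  dsimp only at h
  rw [div_eq_div_iff (by positivity) (by positivity)] at h
  exact (sq_eq_sq₀ hv.le hw.le).1 (by linarith)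

/-- The beta integral on the half line. -/
theorem integral_Ioi_pow_mul_one_add_sq_rpow {k : ℕ} {p : ℝ} (hp : ((k : ℝ) + 1) / 2 < p) :
    ∫ v in Set.Ioi (0:ℝ), v ^ k * (1 + v ^ 2) ^ (-p) =
      beta (((k : ℝ) + 1) / 2) (p - ((k : ℝ) + 1) / 2) / 2 := by
  rw [← integral_Ioo_rpow_mul_one_sub_rpow (by positivity) (by linarith),
    ← image_sq_div_one_add_sq_Ioi,
    integral_image_eq_integral_abs_deriv_smul (f' := fun v => 2 * v / (1 + v ^ 2) ^ 2)
      measurableSet_Ioi ?_ injOn_sq_div_one_add_sq, ← integral_div]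
  · refine setIntegral_congr_fun measurableSet_Ioi fun v hv => ?_
    have hv : 0 < v := hv
    have hD : 0 < 1 + v ^ 2 := by positivity
    have h1 : 1 - v ^ 2 / (1 + v ^ 2) = (1 + v ^ 2)⁻¹ := by field_simp; ring
    rw [h1, abs_of_pos (by positivity), smul_eq_mul, Real.div_rpow (by positivity) hD.le,
      Real.inv_rpow hD.le, ← Real.rpow_neg hD.le, ← Real.rpow_natCast v 2, ← Real.rpow_mul hv.le,
      Real.rpow_natCast v 2]
    have e1 : v ^ k = v * v ^ (((2 : ℕ) : ℝ) * (((k : ℝ) + 1) / 2 - 1)) := by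
      nth_rewrite 2 [← Real.rpow_one v]
      rw [← Real.rpow_add hv, ← Real.rpow_natCast]
      congr 1; push_cast; ring
    rw [e1]
    have e2 : (1 + v ^ 2) ^ (-p) = (1 + v ^ 2) ^ (-(p - ((k : ℝ) + 1) / 2 - 1)) /
        (1 + v ^ 2) ^ (((k : ℝ) + 1) / 2 - 1) / (1 + v ^ 2) ^ 2 := by
      rw [← Real.rpow_natCast (1 + v ^ 2) 2, ← Real.rpow_sub hD, ← Real.rpow_sub hD]
      congr 1; push_cast; ring
    rw [e2]
    field_simp
  · intro v hv
    refine HasDerivAt.hasDerivWithinAt ?_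
    have hD : 1 + v ^ 2 ≠ 0 := by positivity
    have := (hasDerivAt_pow 2 v).div ((hasDerivAt_pow 2 v).const_add 1) hD
    refine this.congr_deriv ?_
    push_cast
    ring

theorem integrableOn_Ioi_pow_mul_one_add_sq_rpow {k : ℕ} {p : ℝ} (hp : ((k : ℝ) + 1) / 2 < p) :
    IntegrableOn (fun v : ℝ => v ^ k * (1 + v ^ 2) ^ (-p)) (Set.Ioi 0) := by
  refine Integrable.of_integral_ne_zero ?_
  rw [integral_Ioi_pow_mul_one_add_sq_rpow hp]
  exact (half_pos (beta_pos (by positivity) (by linarith))).ne'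

theorem integral_sin_pow_eq_Gamma (n : ℕ) :
    ∫ φ in (0:ℝ)..π, sin φ ^ n = √π * Gamma (((n : ℝ) + 1) / 2) / Gamma ((n : ℝ) / 2 + 1) := by
  induction n using Nat.twoStepInduction with
  | zero =>
    have h : Gamma (((0:ℕ) + 1 : ℝ) / 2) = √π := by
      rw [← Real.Gamma_one_half_eq]; norm_num
    rw [h, Real.mul_self_sqrt pi_pos.le]
    simp
  | one =>
    have : Gamma ((1:ℝ) / 2 + 1) = √π / 2 := by
      rw [Real.Gamma_add_one (by norm_num), Real.Gamma_one_half_eq]; ring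
    simp only [Nat.cast_one, this]
    norm_num [integral_sin]
    field_simp
  | more n ih _ =>
    rw [integral_sin_pow, ih]
    have h1 : Gamma ((((n + 2 : ℕ) : ℝ) + 1) / 2) = ((n : ℝ) + 1) / 2 * Gamma (((n : ℝ) + 1) / 2) := by
      rw [← Real.Gamma_add_one (by positivity)]; congr 1; push_cast; ring
    have h2 : Gamma (((n + 2 : ℕ) : ℝ) / 2 + 1) = ((n : ℝ) / 2 + 1) * Gamma ((n : ℝ) / 2 + 1) := by
      rw [← Real.Gamma_add_one (by positivity)]; congr 1; push_cast; ring
    have := (Real.Gamma_pos_of_pos (show 0 < (n : ℝ) / 2 + 1 by positivity)).ne'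
    rw [h1, h2]
    simp
    field_simp

theorem add_sq_add_mul_cos_pos {x r : ℝ} (hx : 0 ≤ x) (hxr : x < r) (φ : ℝ) :
    0 < r ^ 2 + x ^ 2 + 2 * r * x * cos φ := by
  have h : 0 ≤ 2 * r * x * (1 + cos φ) :=
    mul_nonneg (by have := hx.trans hxr.le; positivity) (by linarith [neg_one_le_cos φ])
  nlinarith [pow_pos (sub_pos.2 hxr) 2]

/-- The Poisson kernel has mean one. -/
theorem integral_inv_add_sq_add_mul_cos {x r : ℝ} (hx : 0 ≤ x) (hxr : x < r) :
    ∫ φ in (0:ℝ)..π, (r ^ 2 - x ^ 2) / (r ^ 2 + x ^ 2 + 2 * r * x * cos φ) = π := by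
  have hpos := add_sq_add_mul_cos_pos hx hxr
  have hq : ∀ φ, 0 < r + x * cos φ := fun φ => by nlinarith [neg_one_le_cos φ]
  have hd : ∀ φ ∈ Set.uIcc (0:ℝ) π,
      HasDerivAt (fun φ => φ - 2 * arctan (x * sin φ / (r + x * cos φ)))
        ((r ^ 2 - x ^ 2) / (r ^ 2 + x ^ 2 + 2 * r * x * cos φ)) φ := by
    intro φ _
    have := (hasDerivAt_id φ).sub (((((hasDerivAt_sin φ).const_mul x).div
      (((hasDerivAt_cos φ).const_mul x).const_add r) (hq φ).ne').arctan).const_mul 2)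
    refine this.congr_deriv ?_
    have h1 := (hpos φ).ne'
    have h2 := (hq φ).ne'
    have h3 : 1 + (x * sin φ / (r + x * cos φ)) ^ 2 =
        (r ^ 2 + x ^ 2 + 2 * r * x * cos φ) / (r + x * cos φ) ^ 2 := by
      field_simp
      rw [sin_sq]
      ring
    simp only [Pi.div_apply]
    rw [h3, eq_div_iff h1]
    generalize hD : r ^ 2 + x ^ 2 + 2 * r * x * cos φ = D at h1 ⊢
    field_simp
    linear_combination (-2 * x ^ 2) * sin_sq_add_cos_sq φ - hD
  rw [intervalIntegral.integral_eq_sub_of_hasDerivAt hd]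
  · simp
  · exact (continuous_const.div (by fun_prop) fun φ => (hpos φ).ne').intervalIntegrable _ _

theorem integral_sin_sq_div_add_sq_add_mul_cos {x r : ℝ} (hx : 0 ≤ x) (hxr : x < r) :
    ∫ φ in (0:ℝ)..π, sin φ ^ 2 / (r ^ 2 + x ^ 2 + 2 * r * x * cos φ) = π / (2 * r ^ 2) := by
  have hr : 0 < r := hx.trans_lt hxr
  rcases hx.eq_or_lt with rfl | hx0
  · simp [integral_sin_sq]
    ring
  have hpos := add_sq_add_mul_cos_pos hx hxr
  have hc : Continuous fun φ => (r ^ 2 - x ^ 2) / (r ^ 2 + x ^ 2 + 2 * r * x * cos φ) :=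
    continuous_const.div (by fun_prop) fun φ => (hpos φ).ne'
  have key : ∀ φ, sin φ ^ 2 / (r ^ 2 + x ^ 2 + 2 * r * x * cos φ) =
      (4 * r ^ 2 * x ^ 2)⁻¹ * ((r ^ 2 + x ^ 2) - 2 * r * x * cos φ -
        (r ^ 2 - x ^ 2) * ((r ^ 2 - x ^ 2) / (r ^ 2 + x ^ 2 + 2 * r * x * cos φ))) := by
    intro φ
    have h1 := (hpos φ).ne'
    generalize hD : r ^ 2 + x ^ 2 + 2 * r * x * cos φ = D at h1 ⊢
    have hcos : 2 * r * x * cos φ = D - r ^ 2 - x ^ 2 := by linarith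
    rw [hcos]
    field_simp
    linear_combination 4 * r ^ 2 * x ^ 2 * sin_sq_add_cos_sq φ -
      (2 * r * x * cos φ + (D - r ^ 2 - x ^ 2)) * hcos
  simp_rw [key]
  rw [intervalIntegral.integral_const_mul, intervalIntegral.integral_sub,
    intervalIntegral.integral_sub, intervalIntegral.integral_const_mul,
    intervalIntegral.integral_const_mul, integral_inv_add_sq_add_mul_cos hx hxr]
  · simp
    field_simp
    ring
  all_goals exact Continuous.intervalIntegrable (by fun_prop) _ _

theorem integral_comp_pi_sub (f : ℝ → ℝ) : ∫ φ in (0:ℝ)..π, f (π - φ) = ∫ φ in (0:ℝ)..π, f φ := by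
  simp

theorem pow_sub_mul_nonpos {a b : ℝ} (ha : 0 ≤ a) (hb : 0 ≤ b) (n : ℕ) :
    (a ^ n - b ^ n) * (b ^ 2 - a ^ 2) ≤ 0 := by
  rcases le_total a b with h | h
  · exact mul_nonpos_of_nonpos_of_nonneg (sub_nonpos.2 (pow_le_pow_left₀ ha h n))
      (sub_nonneg.2 (pow_le_pow_left₀ ha h 2))
  · exact mul_nonpos_of_nonneg_of_nonpos (sub_nonneg.2 (pow_le_pow_left₀ hb h n))
      (sub_nonpos.2 (pow_le_pow_left₀ hb h 2))

theorem integral_sin_pow_div_le_of_lt {x r : ℝ} (hx : 0 ≤ x) (hxr : x < r) (n : ℕ) :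
    ∫ φ in (0:ℝ)..π, sin φ ^ (n + 2) / (r ^ 2 + x ^ 2 + 2 * r * x * cos φ) ≤
      (∫ φ in (0:ℝ)..π, sin φ ^ (n + 2)) / r ^ 2 := by
  have hr : 0 < r := hx.trans_lt hxr
  have hpos := add_sq_add_mul_cos_pos hx hxr
  have hpos' : ∀ φ, 0 < r ^ 2 + x ^ 2 - 2 * r * x * cos φ := fun φ => by
    have := hpos (π - φ)
    rw [cos_pi_sub] at this
    linarith
  have hc : ∀ m : ℕ, Continuous fun φ => sin φ ^ m / (r ^ 2 + x ^ 2 + 2 * r * x * cos φ) :=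
    fun m => Continuous.div (by fun_prop) (by fun_prop) fun φ => (hpos φ).ne'
  have hc' : ∀ m : ℕ, Continuous fun φ => sin φ ^ m / (r ^ 2 + x ^ 2 - 2 * r * x * cos φ) :=
    fun m => Continuous.div (by fun_prop) (by fun_prop) fun φ => (hpos' φ).ne'
  have hrefl : ∀ m : ℕ, ∫ φ in (0:ℝ)..π, sin φ ^ m / (r ^ 2 + x ^ 2 - 2 * r * x * cos φ) =
      ∫ φ in (0:ℝ)..π, sin φ ^ m / (r ^ 2 + x ^ 2 + 2 * r * x * cos φ) := fun m => by
    rw [← integral_comp_pi_sub]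
    simp only [sin_pi_sub, cos_pi_sub, mul_neg, sub_neg_eq_add]
  -- the symmetrised excess of the kernel over the constant `r⁻²`
  set e : ℕ → ℝ → ℝ := fun m φ =>
    sin φ ^ m / (r ^ 2 + x ^ 2 + 2 * r * x * cos φ) +
      sin φ ^ m / (r ^ 2 + x ^ 2 - 2 * r * x * cos φ) - 2 / r ^ 2 * sin φ ^ m with he
  have hce : ∀ m, Continuous fun φ => e m φ := fun m => ((hc m).add (hc' m)).sub (by fun_prop)
  have h_int : ∀ m, ∫ φ in (0:ℝ)..π, e m φ =
      2 * (∫ φ in (0:ℝ)..π, sin φ ^ m / (r ^ 2 + x ^ 2 + 2 * r * x * cos φ)) -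
        2 / r ^ 2 * ∫ φ in (0:ℝ)..π, sin φ ^ m := fun m => by
    simp only [he]
    rw [intervalIntegral.integral_sub, intervalIntegral.integral_add, hrefl,
      intervalIntegral.integral_const_mul]
    · ring
    · exact (hc m).intervalIntegrable _ _
    · exact (hc' m).intervalIntegrable _ _
    · exact ((hc m).add (hc' m)).intervalIntegrable _ _
    · exact Continuous.intervalIntegrable (by fun_prop) _ _
  have h2 : ∫ φ in (0:ℝ)..π, e 2 φ = 0 := by
    rw [h_int, integral_sin_sq_div_add_sq_add_mul_cos hx hxr, integral_sin_sq]
    simp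
    field_simp
    ring
  set b : ℝ := √(3 / 4 - x ^ 2 / (4 * r ^ 2)) with hb
  have hb2 : b ^ 2 = 3 / 4 - x ^ 2 / (4 * r ^ 2) := by
    refine Real.sq_sqrt (sub_nonneg.2 ?_)
    rw [div_le_div_iff₀ (by positivity) (by positivity)]
    nlinarith [mul_nonneg hx hr.le]
  have hle : ∀ φ ∈ Set.Icc (0:ℝ) π, e (n + 2) φ ≤ b ^ n * e 2 φ := by
    intro φ hφ
    have hs := pow_sub_mul_nonpos (sin_nonneg_of_mem_Icc hφ) (Real.sqrt_nonneg _ : 0 ≤ b) n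
    have h1 := hpos φ
    have h1' := hpos' φ
    have hid : e (n + 2) φ - b ^ n * e 2 φ = ((sin φ ^ n - b ^ n) * (b ^ 2 - sin φ ^ 2)) *
        (8 * x ^ 2 * sin φ ^ 2 / ((r ^ 2 + x ^ 2 + 2 * r * x * cos φ) *
          (r ^ 2 + x ^ 2 - 2 * r * x * cos φ))) := by
      rw [hb2]
      simp only [he]
      generalize b ^ n = B
      generalize hP : r ^ 2 + x ^ 2 + 2 * r * x * cos φ = P at h1 ⊢
      generalize hQ : r ^ 2 + x ^ 2 - 2 * r * x * cos φ = Q at h1' ⊢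
      have hS : sin φ ^ 2 = 1 - cos φ ^ 2 := sin_sq φ
      have hcore : 1 / P + 1 / Q - 2 / r ^ 2 =
          (3 / 4 - x ^ 2 / (4 * r ^ 2) - sin φ ^ 2) * (8 * x ^ 2 / (P * Q)) := by
        rw [hS]
        field_simp
        rw [← hP, ← hQ]
        ring
      linear_combination (sin φ ^ n - B) * sin φ ^ 2 * hcore
    have := mul_nonpos_of_nonpos_of_nonneg hs (show 0 ≤ 8 * x ^ 2 * sin φ ^ 2 /
      ((r ^ 2 + x ^ 2 + 2 * r * x * cos φ) * (r ^ 2 + x ^ 2 - 2 * r * x * cos φ)) by positivity)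
    linarith
  have hmono := intervalIntegral.integral_mono_on pi_pos.le ((hce (n + 2)).intervalIntegrable (μ := volume) _ _)
    (((hce 2).const_mul (b ^ n)).intervalIntegrable (μ := volume) _ _) hle
  rw [intervalIntegral.integral_const_mul, h2, mul_zero, h_int] at hmono
  rw [div_eq_mul_inv]
  have : (2:ℝ) / r ^ 2 = 2 * (r ^ 2)⁻¹ := div_eq_mul_inv _ _
  rw [this] at hmono
  linarith

theorem integral_sin_pow_div_le {x r : ℝ} (hx : 0 ≤ x) (hr : 0 < r) (hne : r ≠ x) (n : ℕ) :
    ∫ φ in (0:ℝ)..π, sin φ ^ (n + 2) / (r ^ 2 + x ^ 2 + 2 * r * x * cos φ) ≤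
      (∫ φ in (0:ℝ)..π, sin φ ^ (n + 2)) / r ^ 2 := by
  rcases hne.lt_or_gt with h | h
  · have := integral_sin_pow_div_le_of_lt hr.le h n
    have e : ∀ φ, x ^ 2 + r ^ 2 + 2 * x * r * cos φ = r ^ 2 + x ^ 2 + 2 * r * x * cos φ :=
      fun φ => by ring
    simp only [e] at this
    refine this.trans (div_le_div_of_nonneg_left (integral_sin_pow_pos _).le (by positivity) ?_)
    exact pow_le_pow_left₀ hr.le h.le 2
  · exact integral_sin_pow_div_le_of_lt hx h n

theorem le_integral_sin_pow_div {x r : ℝ} (hx : 0 ≤ x) (hr : 0 < r) (hne : r ≠ x) (n : ℕ) :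
    (∫ φ in (0:ℝ)..π, sin φ ^ n) / (r + x) ^ 2 ≤
      ∫ φ in (0:ℝ)..π, sin φ ^ n / (r ^ 2 + x ^ 2 + 2 * r * x * cos φ) := by
  have hpos : ∀ φ, 0 < r ^ 2 + x ^ 2 + 2 * r * x * cos φ := fun φ => by
    rcases hne.lt_or_gt with h | h
    · have := add_sq_add_mul_cos_pos hr.le h φ
      nlinarith
    · exact add_sq_add_mul_cos_pos hx h φ
  rw [← intervalIntegral.integral_div]
  refine intervalIntegral.integral_mono_on pi_pos.le
    (Continuous.intervalIntegrable (by fun_prop) 0 π)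
    (Continuous.intervalIntegrable (μ := volume) (Continuous.div (by fun_prop) (by fun_prop)
      fun φ => (hpos φ).ne') _ _) fun φ hφ => ?_
  refine div_le_div_of_nonneg_left (pow_nonneg (sin_nonneg_of_mem_Icc hφ) n) (hpos φ) ?_
  nlinarith [mul_nonneg (mul_nonneg hr.le hx) (sub_nonneg.2 (cos_le_one φ))]

section Primitive

open Filter Topology

variable {h : ℝ → ℝ} {x : ℝ}

theorem integrableOn_Ioi_div_add (hx : 0 ≤ x) (hc : Continuous h) (h0 : ∀ s, 0 ≤ s → 0 ≤ h s)
    (hi : IntegrableOn (fun s => h s / s) (Set.Ioi 0)) :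
    IntegrableOn (fun s => h s / (s + x)) (Set.Ioi 0) := by
  refine Integrable.mono' hi (hc.measurable.div (by fun_prop)).aestronglyMeasurable ?_
  refine ae_restrict_of_forall_mem measurableSet_Ioi fun s hs => ?_
  have hs : 0 < s := hs
  have := h0 s hs.le
  rw [Real.norm_of_nonneg (by positivity)]
  exact div_le_div_of_nonneg_left this hs (by linarith)

theorem primitive_nonneg (h0 : ∀ s, 0 ≤ s → 0 ≤ h s) {r : ℝ} (hr : 0 ≤ r) :
    0 ≤ ∫ s in (0:ℝ)..r, h s :=
  intervalIntegral.integral_nonneg hr fun s hs => h0 s hs.1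

theorem integrableOn_and_integral_primitive_div_add_sq (hx : 0 ≤ x) (hc : Continuous h)
    (h0 : ∀ s, 0 ≤ s → 0 ≤ h s) (hh : IntegrableOn h (Set.Ioi 0))
    (hi : IntegrableOn (fun s => h s / s) (Set.Ioi 0)) :
    IntegrableOn (fun r => (∫ s in (0:ℝ)..r, h s) / (r + x) ^ 2) (Set.Ioi 0) ∧
      ∫ r in Set.Ioi (0:ℝ), (∫ s in (0:ℝ)..r, h s) / (r + x) ^ 2 =
        ∫ s in Set.Ioi (0:ℝ), h s / (s + x) := by
  have hq := integrableOn_Ioi_div_add hx hc h0 hi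
  have hqI : ∀ r, 0 ≤ r → IntervalIntegrable (fun s => h s / (s + x)) volume 0 r := fun r hr =>
    (intervalIntegrable_iff_integrableOn_Ioc_of_le hr).2 (hq.mono_set Set.Ioc_subset_Ioi_self)
  have hQ : ContinuousWithinAt (fun r => ∫ s in (0:ℝ)..r, h s / (s + x)) (Set.Ici 0) 0 := by
    rw [← continuousWithinAt_Icc_iff_Ici (zero_lt_one (α := ℝ))]
    have := intervalIntegral.continuousOn_primitive_interval (a := 0) (b := 1) (μ := volume)
      (f := fun s => h s / (s + x)) (by
        rw [Set.uIcc_of_le zero_le_one, integrableOn_Icc_iff_integrableOn_Ioc]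
        exact hq.mono_set Set.Ioc_subset_Ioi_self)
    rw [Set.uIcc_of_le zero_le_one] at this
    exact this 0 (by simp)
  have hH : ContinuousWithinAt (fun r => (∫ s in (0:ℝ)..r, h s) / (r + x)) (Set.Ici 0) 0 := by
    have hQ0 := hQ.tendsto
    simp only [intervalIntegral.integral_same] at hQ0
    simp only [ContinuousWithinAt, intervalIntegral.integral_same, zero_div]
    refine tendsto_of_tendsto_of_tendsto_of_le_of_le' tendsto_const_nhds hQ0 ?_ ?_
    · filter_upwards [self_mem_nhdsWithin] with r hr
      have hr : 0 ≤ r := hr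
      exact div_nonneg (primitive_nonneg h0 hr) (by positivity)
    · filter_upwards [self_mem_nhdsWithin] with r hr
      have hr : 0 ≤ r := hr
      rw [← intervalIntegral.integral_div]
      refine intervalIntegral.integral_mono_on_of_le_Ioo hr
        ((hc.intervalIntegrable 0 r).div_const _) (hqI r hr) fun s hs => ?_
      exact div_le_div_of_nonneg_left (h0 s hs.1.le) (by linarith [hs.1]) (by linarith [hs.2])
  have hder : ∀ r ∈ Set.Ioi (0:ℝ), HasDerivAt
      (fun r => (∫ s in (0:ℝ)..r, h s / (s + x)) - (∫ s in (0:ℝ)..r, h s) / (r + x))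
      ((∫ s in (0:ℝ)..r, h s) / (r + x) ^ 2) r := by
    intro r hr
    have hr : 0 < r := hr
    have hrx : r + x ≠ 0 := by positivity
    have hm : Measurable fun s => h s / (s + x) := hc.measurable.div (by fun_prop)
    have d1 := intervalIntegral.integral_hasDerivAt_right (hqI r hr.le)
      hm.stronglyMeasurable.stronglyMeasurableAtFilter
      (hc.continuousAt.div (by fun_prop) hrx)
    have d2 := (hc.integral_hasStrictDerivAt 0 r).hasDerivAt.div
      ((hasDerivAt_id r).add_const x) hrx
    refine (d1.sub d2).congr_deriv ?_
    simp only [id]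
    field_simp
    ring
  have hlim : Tendsto
      (fun r => (∫ s in (0:ℝ)..r, h s / (s + x)) - (∫ s in (0:ℝ)..r, h s) / (r + x))
      atTop (𝓝 (∫ s in Set.Ioi (0:ℝ), h s / (s + x))) := by
    have := (intervalIntegral_tendsto_integral_Ioi 0 hq tendsto_id).sub
      ((intervalIntegral_tendsto_integral_Ioi 0 hh tendsto_id).div_atTop
        (tendsto_atTop_add_const_right atTop x tendsto_id))
    simpa using this
  have hpos : ∀ r ∈ Set.Ioi (0:ℝ), 0 ≤ (∫ s in (0:ℝ)..r, h s) / (r + x) ^ 2 := fun r hr =>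
    div_nonneg (primitive_nonneg h0 (le_of_lt hr)) (sq_nonneg _)
  refine ⟨integrableOn_Ioi_deriv_of_nonneg (hQ.sub hH) hder hpos hlim, ?_⟩
  rw [integral_Ioi_of_hasDerivAt_of_nonneg (hQ.sub hH) hder hpos hlim]
  simp

end Primitive

/-- The weight `s ^ d * (1 + s ^ 2) ^ (-d - 1/2)` whose primitive gives the radial profile. -/
def radialWeight (d : ℕ) (s : ℝ) : ℝ := s ^ d * (1 + s ^ 2) ^ (-((d : ℝ) + 1/2))

theorem continuous_radialWeight (d : ℕ) : Continuous (radialWeight d) :=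
  (continuous_pow d).mul (Continuous.rpow_const (by fun_prop) fun s => Or.inl (by positivity))

theorem radialWeight_nonneg (d : ℕ) {s : ℝ} (hs : 0 ≤ s) : 0 ≤ radialWeight d s := by
  unfold radialWeight
  positivity

theorem integral_rpow_mul_one_add_mul_sq_rpow {d : ℕ} (hd : 1 ≤ d) {r : ℝ} (hr : 0 < r) :
    (∫ t in (0:ℝ)..1, t ^ (((d : ℝ) - 1)/2) * (1 + t * r^2) ^ (-(d : ℝ) - 1/2)) * r ^ (d + 1) =
      2 * ∫ s in (0:ℝ)..r, radialWeight d s := by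
  have hd' : (1:ℝ) ≤ d := by exact_mod_cast hd
  have key := intervalIntegral.integral_comp_mul_deriv'' (a := 0) (b := r)
    (f := fun s => s ^ 2 / r ^ 2) (f' := fun s => 2 * s / r ^ 2)
    (g := fun t => t ^ (((d : ℝ) - 1)/2) * (1 + t * r^2) ^ (-(d : ℝ) - 1/2))
    (by fun_prop)
    (fun s _ => by
      have := ((hasDerivAt_pow 2 s).div_const (r ^ 2)).hasDerivWithinAt (s := Set.Ioi s)
      simpa using this)
    (by fun_prop)
    (by
      refine ContinuousOn.mul (ContinuousOn.rpow_const (by fun_prop) fun t _ =>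
        Or.inr (by linarith)) (ContinuousOn.rpow_const (by fun_prop) ?_)
      rintro _ ⟨s, _, rfl⟩
      left
      have : 0 ≤ s ^ 2 / r ^ 2 * r ^ 2 := by positivity
      linarith)
  rw [div_self (by positivity)] at key
  simp only [ne_eq, OfNat.ofNat_ne_zero, not_false_eq_true, zero_pow, zero_div] at key
  rw [← key, ← intervalIntegral.integral_mul_const, ← intervalIntegral.integral_const_mul]
  refine intervalIntegral.integral_congr fun s hs => ?_
  rw [Set.uIcc_of_le hr.le] at hs
  have e1 : (s ^ 2 / r ^ 2) ^ (((d : ℝ) - 1)/2) = (s / r) ^ (d - 1) := by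
    rw [← div_pow, ← Real.rpow_natCast (s / r) 2, ← Real.rpow_mul (div_nonneg hs.1 hr.le),
      ← Real.rpow_natCast, Nat.cast_sub hd]
    congr 1; push_cast; ring
  have e2 : s ^ 2 / r ^ 2 * r ^ 2 = s ^ 2 := by field_simp
  obtain ⟨n, rfl⟩ := Nat.exists_eq_add_of_le' hd
  simp only [Function.comp_apply, radialWeight]
  rw [e1, e2, show -((n + 1 : ℕ) : ℝ) - 1/2 = -(((n + 1 : ℕ) : ℝ) + 1/2) by ring,
    Nat.add_sub_cancel, div_pow]
  field_simp
  ring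

theorem pow_mul_radialWeight (d k : ℕ) (s : ℝ) :
    s ^ k * radialWeight d s = s ^ (d + k) * (1 + s ^ 2) ^ (-((d : ℝ) + 1/2)) := by
  rw [radialWeight, pow_add]; ring

theorem integrableOn_pow_mul_radialWeight {d : ℕ} (hd : 2 ≤ d) {k : ℕ} (hk : k ≤ 1) :
    IntegrableOn (fun s => s ^ k * radialWeight d s) (Set.Ioi 0) := by
  have hd' : (2:ℝ) ≤ d := by exact_mod_cast hd
  have hk' : (k:ℝ) ≤ 1 := by exact_mod_cast hk
  simp only [pow_mul_radialWeight]
  exact integrableOn_Ioi_pow_mul_one_add_sq_rpow (by push_cast; linarith)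

theorem radialWeight_div {d : ℕ} (hd : 1 ≤ d) (s : ℝ) (hs : s ≠ 0) :
    radialWeight d s / s = s ^ (d - 1) * (1 + s ^ 2) ^ (-((d : ℝ) + 1/2)) := by
  obtain ⟨n, rfl⟩ := Nat.exists_eq_add_of_le' hd
  rw [radialWeight, Nat.add_sub_cancel]
  field_simp
  ring

theorem integrableOn_radialWeight_div {d : ℕ} (hd : 1 ≤ d) :
    IntegrableOn (fun s => radialWeight d s / s) (Set.Ioi 0) := by
  have hd' : (1:ℝ) ≤ d := by exact_mod_cast hd
  refine (integrableOn_congr_fun (fun s (hs : 0 < s) => radialWeight_div hd s hs.ne')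
    measurableSet_Ioi).2 (integrableOn_Ioi_pow_mul_one_add_sq_rpow ?_)
  push_cast [Nat.cast_sub hd]
  linarith

theorem integral_radialWeight (d : ℕ) (hd : 1 ≤ d) :
    ∫ s in Set.Ioi (0:ℝ), radialWeight d s =
      Gamma (((d : ℝ) + 1) / 2) * Gamma ((d : ℝ) / 2) / Gamma ((d : ℝ) + 1 / 2) / 2 := by
  have hd' : (1:ℝ) ≤ d := by exact_mod_cast hd
  simp only [radialWeight]
  rw [integral_Ioi_pow_mul_one_add_sq_rpow (by linarith), beta, add_sub_cancel,
    show (d : ℝ) + 1 / 2 - ((d : ℝ) + 1) / 2 = (d : ℝ) / 2 by ring]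

theorem integral_radialWeight_div (d : ℕ) (hd : 1 ≤ d) :
    ∫ s in Set.Ioi (0:ℝ), radialWeight d s / s = ∫ s in Set.Ioi (0:ℝ), radialWeight d s := by
  have hd' : (1:ℝ) ≤ d := by exact_mod_cast hd
  rw [integral_radialWeight d hd,
    setIntegral_congr_fun measurableSet_Ioi (fun s (hs : 0 < s) => radialWeight_div hd s hs.ne'),
    integral_Ioi_pow_mul_one_add_sq_rpow (by push_cast [Nat.cast_sub hd]; linarith), beta,
    add_sub_cancel, Nat.cast_sub hd, Nat.cast_one, sub_add_cancel,
    show (d : ℝ) + 1 / 2 - (d : ℝ) / 2 = ((d : ℝ) + 1) / 2 by ring,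
    mul_comm (Gamma (((d : ℝ) + 1) / 2))]

theorem integral_mul_radialWeight_le (d : ℕ) (hd : 2 ≤ d) :
    ∫ s in Set.Ioi (0:ℝ), s * radialWeight d s ≤ 2 * ∫ s in Set.Ioi (0:ℝ), radialWeight d s := by
  have hd' : (2:ℝ) ≤ d := by exact_mod_cast hd
  have h := pow_mul_radialWeight d 1
  simp only [pow_one] at h
  simp only [h]
  rw [integral_radialWeight d (by lia),
    integral_Ioi_pow_mul_one_add_sq_rpow (by push_cast; linarith), beta]
  have e1 : Gamma ((((d + 1 : ℕ) : ℝ) + 1) / 2) = (d : ℝ) / 2 * Gamma ((d : ℝ) / 2) := by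
    rw [← Real.Gamma_add_one (by positivity)]; congr 1; push_cast; ring
  have e2 : Gamma (((d : ℝ) + 1) / 2) = ((d : ℝ) - 1) / 2 * Gamma (((d : ℝ) - 1) / 2) := by
    rw [← Real.Gamma_add_one (by linarith)]; congr 1; ring
  have e3 : (d : ℝ) + 1 / 2 - (((d + 1 : ℕ) : ℝ) + 1) / 2 = ((d : ℝ) - 1) / 2 := by
    push_cast; ring
  rw [add_sub_cancel, e3, e1, e2]
  have g1 : 0 < Gamma ((d : ℝ) / 2) := Real.Gamma_pos_of_pos (by positivity)
  have g2 : 0 < Gamma (((d : ℝ) - 1) / 2) := Real.Gamma_pos_of_pos (by linarith)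
  have g3 : 0 < Gamma ((d : ℝ) + 1 / 2) := Real.Gamma_pos_of_pos (by positivity)
  rw [← mul_div_assoc, ← mul_div_assoc]
  gcongr ?_ / _ / _
  nlinarith [mul_pos g1 g2]

theorem le_integral_radialWeight_div_add (d : ℕ) (hd : 2 ≤ d) {x : ℝ} (hx : 0 ≤ x) :
    (∫ s in Set.Ioi (0:ℝ), radialWeight d s) / (x + 2) ≤
      ∫ s in Set.Ioi (0:ℝ), radialWeight d s / (s + x) := by
  have i0 := integrableOn_pow_mul_radialWeight hd zero_le_one
  have i1 := integrableOn_pow_mul_radialWeight hd le_rfl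
  simp only [pow_zero, one_mul, pow_one] at i0 i1
  have hx2 : 0 < x + 2 := by linarith
  have hmono : ∫ s in Set.Ioi (0:ℝ), ((x + 4) / (x + 2) ^ 2 * radialWeight d s -
      1 / (x + 2) ^ 2 * (s * radialWeight d s)) ≤
      ∫ s in Set.Ioi (0:ℝ), radialWeight d s / (s + x) := by
    refine setIntegral_mono_on ((i0.const_mul _).sub (i1.const_mul _))
      (integrableOn_Ioi_div_add hx (continuous_radialWeight d)
        (fun s => radialWeight_nonneg d) (integrableOn_radialWeight_div (by lia)))
      measurableSet_Ioi fun s hs => ?_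
    have hs : 0 < s := hs
    have htan : (x + 4) / (x + 2) ^ 2 - 1 / (x + 2) ^ 2 * s ≤ 1 / (s + x) := by
      have : 1 / (s + x) - ((x + 4) / (x + 2) ^ 2 - 1 / (x + 2) ^ 2 * s) =
          (s - 2) ^ 2 / ((x + 2) ^ 2 * (s + x)) := by
        field_simp
        ring
      have h2 : 0 ≤ (s - 2) ^ 2 / ((x + 2) ^ 2 * (s + x)) := by positivity
      linarith
    have := mul_le_mul_of_nonneg_right htan (radialWeight_nonneg d hs.le)
    calc _ = ((x + 4) / (x + 2) ^ 2 - 1 / (x + 2) ^ 2 * s) * radialWeight d s := by ring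
      _ ≤ _ := this
      _ = _ := by ring
  refine le_trans ?_ hmono
  rw [integral_sub (i0.const_mul _) (i1.const_mul _), integral_const_mul, integral_const_mul]
  have hle := integral_mul_radialWeight_le d hd
  have := mul_le_mul_of_nonneg_left hle (show 0 ≤ 1 / (x + 2) ^ 2 by positivity)
  refine le_trans (le_of_eq ?_) (sub_le_sub_left this
    ((x + 4) / (x + 2) ^ 2 * ∫ s in Set.Ioi (0:ℝ), radialWeight d s))
  field_simp
  ring

theorem Kfun_const_eq {d : ℕ} (hd : 2 ≤ d) :
    sphereArea (d - 2) * (∫ φ in (0:ℝ)..π, sin φ ^ d) *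
      (2 * (Gamma ((d : ℝ) + 1/2) / (2 * π ^ ((d : ℝ)/2) * Gamma (((d : ℝ) + 1)/2))) *
        ∫ s in Set.Ioi (0:ℝ), radialWeight d s) = ((d : ℝ) - 1) / d := by
  have hd' : (2:ℝ) ≤ d := by exact_mod_cast hd
  have hd1 : 0 < ((d : ℝ) - 1) / 2 := by linarith
  have g1 := (Real.Gamma_pos_of_pos (show 0 < (d : ℝ) / 2 by positivity)).ne'
  have g2 := (Real.Gamma_pos_of_pos hd1).ne'
  have g3 := (Real.Gamma_pos_of_pos (show 0 < (d : ℝ) + 1 / 2 by positivity)).ne'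
  have e1 : Gamma ((d : ℝ) / 2 + 1) = (d : ℝ) / 2 * Gamma ((d : ℝ) / 2) :=
    Real.Gamma_add_one (by positivity)
  have e2 : Gamma (((d : ℝ) + 1) / 2) = ((d : ℝ) - 1) / 2 * Gamma (((d : ℝ) - 1) / 2) := by
    rw [← Real.Gamma_add_one hd1.ne']; congr 1; ring
  have e3 : (((d - 2 : ℕ) : ℝ) + 1) / 2 = ((d : ℝ) - 1) / 2 := by
    push_cast [Nat.cast_sub hd]; ring
  have e4 : π ^ ((d : ℝ) / 2) = π ^ (((d : ℝ) - 1) / 2) * √π := by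
    rw [Real.sqrt_eq_rpow, ← Real.rpow_add pi_pos]; congr 1; ring
  have p1 : π ^ (((d : ℝ) - 1) / 2) ≠ 0 := (Real.rpow_pos_of_pos pi_pos _).ne'
  have p2 : √π ≠ 0 := (Real.sqrt_pos.2 pi_pos).ne'
  have d1 : (d : ℝ) - 1 ≠ 0 := by linarith
  rw [sphereArea, integral_radialWeight d (by lia), integral_sin_pow_eq_Gamma, e3, e4, e1, e2]
  generalize Gamma ((d : ℝ) / 2) = G1 at *
  generalize Gamma (((d : ℝ) - 1) / 2) = G2 at *
  generalize Gamma ((d : ℝ) + 1 / 2) = G3 at *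
  generalize π ^ (((d : ℝ) - 1) / 2) = P at *
  field_simp

theorem Kfun_eq {d : ℕ} (hd : 2 ≤ d) (x : ℝ) :
    Kfun d x = sphereArea (d - 2) *
      (2 * (Gamma ((d : ℝ) + 1/2) / (2 * π ^ ((d : ℝ)/2) * Gamma (((d : ℝ) + 1)/2))) *
        ∫ r in Set.Ioi (0:ℝ),
          (∫ φ in (0:ℝ)..π, sin φ ^ d / (r ^ 2 + x ^ 2 + 2 * r * x * cos φ)) *
            ∫ s in (0:ℝ)..r, radialWeight d s) := by
  rw [Kfun]
  congr 1
  rw [← integral_const_mul]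
  refine setIntegral_congr_fun measurableSet_Ioi fun r (hr : 0 < r) => ?_
  rw [ftilde]
  linear_combination (∫ φ in (0:ℝ)..π, sin φ ^ d / (r ^ 2 + x ^ 2 + 2 * r * x * cos φ)) *
    (Gamma ((d : ℝ) + 1/2) / (2 * π ^ ((d : ℝ)/2) * Gamma (((d : ℝ) + 1)/2))) *
    integral_rpow_mul_one_add_mul_sq_rpow (d := d) (by lia) hr

theorem measurable_integral_sin_pow_div (n : ℕ) (x : ℝ) :
    Measurable fun r : ℝ =>
      ∫ φ in (0:ℝ)..π, sin φ ^ n / (r ^ 2 + x ^ 2 + 2 * r * x * cos φ) := by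
  have hm : Measurable fun z : ℝ × ℝ =>
      sin z.2 ^ n / (z.1 ^ 2 + x ^ 2 + 2 * z.1 * x * cos z.2) := by fun_prop
  simp only [intervalIntegral.integral_of_le pi_pos.le]
  exact (hm.stronglyMeasurable.integral_prod_right
    (ν := volume.restrict (Set.Ioc 0 π))).measurable

theorem integral_kernel_mul_primitive_bounds {d : ℕ} (hd : 2 ≤ d) {x : ℝ} (hx : 0 ≤ x) :
    (∫ φ in (0:ℝ)..π, sin φ ^ d) * ((∫ s in Set.Ioi (0:ℝ), radialWeight d s) / (x + 2)) ≤
      ∫ r in Set.Ioi (0:ℝ),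
        (∫ φ in (0:ℝ)..π, sin φ ^ d / (r ^ 2 + x ^ 2 + 2 * r * x * cos φ)) *
          ∫ s in (0:ℝ)..r, radialWeight d s ∧
    ∫ r in Set.Ioi (0:ℝ),
        (∫ φ in (0:ℝ)..π, sin φ ^ d / (r ^ 2 + x ^ 2 + 2 * r * x * cos φ)) *
          ∫ s in (0:ℝ)..r, radialWeight d s ≤
      (∫ φ in (0:ℝ)..π, sin φ ^ d) * ∫ s in Set.Ioi (0:ℝ), radialWeight d s := by
  obtain ⟨n, rfl⟩ := Nat.exists_eq_add_of_le' hd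
  have hc := continuous_radialWeight (n + 2)
  have h0 : ∀ s, 0 ≤ s → 0 ≤ radialWeight (n + 2) s := fun s => radialWeight_nonneg (n + 2)
  have i0 := integrableOn_pow_mul_radialWeight hd zero_le_one
  simp only [pow_zero, one_mul] at i0
  have i1 := integrableOn_radialWeight_div (d := n + 2) (by lia)
  obtain ⟨iu, eu⟩ := integrableOn_and_integral_primitive_div_add_sq le_rfl hc h0 i0 i1
  obtain ⟨il, el⟩ := integrableOn_and_integral_primitive_div_add_sq hx hc h0 i0 i1
  simp only [add_zero] at iu eu
  rw [integral_radialWeight_div _ (by lia)] at eu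
  have hB := integral_sin_pow_pos (n + 2)
  have hae : ∀ᵐ r ∂volume.restrict (Set.Ioi (0:ℝ)), 0 < r ∧ r ≠ x :=
    (ae_restrict_mem measurableSet_Ioi).and (ae_restrict_of_ae (Measure.ae_ne volume x))
  have hlow : ∀ᵐ r ∂volume.restrict (Set.Ioi (0:ℝ)),
      (∫ φ in (0:ℝ)..π, sin φ ^ (n + 2)) *
        ((∫ s in (0:ℝ)..r, radialWeight (n + 2) s) / (r + x) ^ 2) ≤
      (∫ φ in (0:ℝ)..π, sin φ ^ (n + 2) / (r ^ 2 + x ^ 2 + 2 * r * x * cos φ)) *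
          ∫ s in (0:ℝ)..r, radialWeight (n + 2) s := by
    filter_upwards [hae] with r hr
    rw [← mul_div_assoc, ← div_mul_eq_mul_div]
    exact mul_le_mul_of_nonneg_right (le_integral_sin_pow_div hx hr.1 hr.2 _)
      (primitive_nonneg h0 hr.1.le)
  have hupp : ∀ᵐ r ∂volume.restrict (Set.Ioi (0:ℝ)),
      (∫ φ in (0:ℝ)..π, sin φ ^ (n + 2) / (r ^ 2 + x ^ 2 + 2 * r * x * cos φ)) *
          ∫ s in (0:ℝ)..r, radialWeight (n + 2) s ≤
      (∫ φ in (0:ℝ)..π, sin φ ^ (n + 2)) *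
        ((∫ s in (0:ℝ)..r, radialWeight (n + 2) s) / r ^ 2) := by
    filter_upwards [hae] with r hr
    rw [← mul_div_assoc, ← div_mul_eq_mul_div]
    exact mul_le_mul_of_nonneg_right (integral_sin_pow_div_le hx hr.1 hr.2 _)
      (primitive_nonneg h0 hr.1.le)
  have h_int : IntegrableOn (fun r =>
      (∫ φ in (0:ℝ)..π, sin φ ^ (n + 2) / (r ^ 2 + x ^ 2 + 2 * r * x * cos φ)) *
          ∫ s in (0:ℝ)..r, radialWeight (n + 2) s) (Set.Ioi 0) := by
    refine Integrable.mono' (iu.const_mul (∫ φ in (0:ℝ)..π, sin φ ^ (n + 2)))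
      ((measurable_integral_sin_pow_div _ x).mul
      (intervalIntegral.continuous_primitive (fun a b => hc.intervalIntegrable a b)
        0).measurable).aestronglyMeasurable ?_
    filter_upwards [hae, hlow, hupp] with r hr hl hu
    rw [Real.norm_of_nonneg]
    · exact hu
    · refine le_trans ?_ hl
      exact mul_nonneg hB.le (div_nonneg (primitive_nonneg h0 hr.1.le) (sq_nonneg _))
  constructor
  · refine (mul_le_mul_of_nonneg_left (le_integral_radialWeight_div_add _ hd hx) hB.le).trans ?_
    rw [← el, ← integral_const_mul]
    exact integral_mono_ae (il.const_mul _) h_int hlow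
  · rw [← eu, ← integral_const_mul]
    exact integral_mono_ae h_int (iu.const_mul _) hupp

/-- bounds on `K`. For every integer `d ≥ 2` and every `x ≥ 0`,
`(d−1)/(d(x+2)) ≤ K(x) ≤ (d−1)/d`. -/
theorem statement18 {d : ℕ} (hd : 2 ≤ d) (x : ℝ) (hx : 0 ≤ x) :
    ((d : ℝ) - 1) / ((d : ℝ) * (x + 2)) ≤ Kfun d x ∧ Kfun d x ≤ ((d : ℝ) - 1) / (d : ℝ) := by
  have hd' : (2:ℝ) ≤ d := by exact_mod_cast hd
  obtain ⟨hl, hu⟩ := integral_kernel_mul_primitive_bounds hd hx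
  have hS : 0 ≤ sphereArea (d - 2) *
      (2 * (Gamma ((d : ℝ) + 1/2) / (2 * π ^ ((d : ℝ)/2) * Gamma (((d : ℝ) + 1)/2)))) := by
    have := (Real.Gamma_pos_of_pos (show 0 < (d : ℝ) + 1/2 by positivity)).le
    have := (Real.Gamma_pos_of_pos (show 0 < ((d : ℝ) + 1)/2 by positivity)).le
    have := (Real.Gamma_pos_of_pos (show 0 < (((d - 2 : ℕ) : ℝ) + 1)/2 by positivity)).le
    unfold sphereArea
    positivity
  have hl' := mul_le_mul_of_nonneg_left hl hS
  have hu' := mul_le_mul_of_nonneg_left hu hS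
  rw [Kfun_eq hd, ← mul_assoc (sphereArea (d - 2)), ← div_div, ← Kfun_const_eq hd]
  constructor
  · refine le_trans (le_of_eq ?_) hl'
    ring
  · refine hu'.trans (le_of_eq ?_)
    ring
end
end
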